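/- arXiv:2602.20081 — 5 statements merged into one kernel-verified Lean document; each statement's English description precedes it below -/
import Mathlib

section
/- Let J be a real m×n matrix and let μ ∈ ℝ satisfy μ ≥ ‖J‖_tr. Then for every ψ ∈ W: μ·‖ψ‖² + Σ_{α=1}^{m} Σ_{i=1}^{n} J_{αi} · Re⟨e_i η_α ψ, ψ⟩ ≥ 0. -/
open scoped ComplexInnerProductSpace

/-- The trace norm of a real `m × n` matrix `P`: the sum of the square roots of the
eigenvalues of the symmetric positive semidefinite matrix `P * Pᵀ`,
i.e. the sum of the singular values of `P`. -/
noncomputable def traceNorm {m n : ℕ} (P : Matrix (Fin m) (Fin n) ℝ) : ℝ :=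
  ∑ s : Fin m, Real.sqrt ((Matrix.isHermitian_mul_conjTranspose_self P).eigenvalues s)

section

open scoped Matrix

/-- An anticommuting family of operators whose squares and adjoints carry the same sign `c`
sends each vector to an orthogonal family (for the real inner product) of vectors of the same
norm. -/
theorem re_inner_clifford_apply {ι W : Type*} [DecidableEq ι] [NormedAddCommGroup W]
    [InnerProductSpace ℂ W] (A : ι → Module.End ℂ W) (c : ℂ) (hc : c * c = 1)
    (hA : ∀ i j, A i * A j + A j * A i = (if i = j then 2 * c else 0) • 1)
    (hadj : ∀ i (ψ φ : W), ⟪A i ψ, φ⟫ = c * ⟪ψ, A i φ⟫) (φ : W) (i j : ι) :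
    (⟪A i φ, A j φ⟫).re = if i = j then ‖φ‖ ^ 2 else 0 := by
  have hsum : ⟪A i φ, A j φ⟫ + ⟪A j φ, A i φ⟫ = if i = j then 2 * (‖φ‖ : ℂ) ^ 2 else 0 := by
    have h : A i (A j φ) + A j (A i φ) = (if i = j then 2 * c else 0) • φ := 
      LinearMap.congr_fun (hA i j) φ
    rw [hadj, hadj, ← mul_add, ← inner_add_right, h, inner_smul_right,
      inner_self_eq_norm_sq_to_K]
    split_ifs
    · simp only [Complex.coe_algebraMap]
      linear_combination 2 * (‖φ‖ : ℂ) ^ 2 * hc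
    · simp
  have hre := congrArg Complex.re hsum
  have hsymm : (⟪A j φ, A i φ⟫).re = (⟪A i φ, A j φ⟫).re := inner_re_symm (𝕜 := ℂ) _ _
  rw [Complex.add_re, hsymm] at hre
  split_ifs at hre ⊢
  · norm_cast at hre
    linarith
  · simp at hre
    linarith

/-- Clifford multiplication by a real vector scales norms by the length of that vector. -/
theorem norm_sq_sum_smul_clifford_apply {ι W : Type*} [Fintype ι] [DecidableEq ι]
    [NormedAddCommGroup W] [InnerProductSpace ℂ W] (A : ι → Module.End ℂ W) (c : ℂ)
    (hc : c * c = 1)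
    (hA : ∀ i j, A i * A j + A j * A i = (if i = j then 2 * c else 0) • 1)
    (hadj : ∀ i (ψ φ : W), ⟪A i ψ, φ⟫ = c * ⟪ψ, A i φ⟫) (φ : W) (v : ι → ℝ) :
    ‖∑ i, (v i : ℂ) • A i φ‖ ^ 2 = (∑ i, v i ^ 2) * ‖φ‖ ^ 2 := by
  rw [← inner_self_eq_norm_sq (𝕜 := ℂ)]
  simp only [sum_inner, inner_sum, inner_smul_left, inner_smul_right, Complex.conj_ofReal,
    RCLike.re_to_complex, Complex.re_sum, Complex.re_ofReal_mul,
    re_inner_clifford_apply A c hc hA hadj]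
  simp [Finset.sum_mul, sq, mul_assoc]

/-- Every real matrix `J` is a sum of rank-one matrices `u s ⊗ v s`, with unit vectors `u s` and
with `v s` of squared length the `s`-th eigenvalue of `J * Jᵀ`. -/
theorem exists_rankOne_decomposition {m n : ℕ} (J : Matrix (Fin m) (Fin n) ℝ) :
    ∃ (u : Fin m → Fin m → ℝ) (v : Fin m → Fin n → ℝ),
      (∀ s, ∑ α, u s α ^ 2 = 1) ∧
      (∀ s, ∑ i, v s i ^ 2 = (Matrix.isHermitian_mul_conjTranspose_self J).eigenvalues s) ∧
      ∀ α i, J α i = ∑ s, u s α * v s i := by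
  set hJ := Matrix.isHermitian_mul_conjTranspose_self J
  let b := hJ.eigenvectorBasis
  refine ⟨fun s α => b s α, fun s => (b s).ofLp ᵥ* J, fun s => ?_, fun s => ?_, fun α i => ?_⟩
  · simp [← EuclideanSpace.real_norm_sq_eq]
  · rw [hJ.eigenvalues_eq s]
    change _ = (b s).ofLp ⬝ᵥ (J * Jᴴ) *ᵥ (b s).ofLp
    clear_value b
    rw [← Matrix.mulVec_mulVec, Matrix.dotProduct_mulVec,
      Matrix.conjTranspose_eq_transpose_of_trivial, Matrix.mulVec_transpose]
    simp [dotProduct, sq]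
  · have hδ : ∀ β, ∑ s, b s α * b s β = if α = β then 1 else 0 := fun β => by
      have h := b.sum_inner_mul_inner (EuclideanSpace.single α (1 : ℝ))
        (EuclideanSpace.single β (1 : ℝ))
      simpa [EuclideanSpace.inner_single_left, EuclideanSpace.inner_single_right, eq_comm] using h
    simp only [Matrix.vecMul, dotProduct, Finset.mul_sum, ← mul_assoc]
    rw [Finset.sum_comm]
    simp [← Finset.sum_mul, hδ]

end

/-- if `μ ≥ ‖J‖_tr` then the spinorial energy density
`μ‖ψ‖² + Σ_{α,i} J_{αi} Re⟨e_i η_α ψ, ψ⟩` is nonnegative. -/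
theorem dec_implies_pointwise_nonneg {n m : ℕ} (hn : 0 < n) (hm : 0 < m)
    {W : Type*} [NormedAddCommGroup W] [InnerProductSpace ℂ W]
    (e : Fin n → Module.End ℂ W) (η : Fin m → Module.End ℂ W)
    (he : ∀ i j, e i * e j + e j * e i = (if i = j then (-2 : ℂ) else 0) • 1)
    (hη : ∀ α β, η α * η β + η β * η α = (if α = β then (2 : ℂ) else 0) • 1)
    (heη : ∀ i α, e i * η α + η α * e i = 0)
    (he_adj : ∀ i (ψ φ : W), ⟪e i ψ, φ⟫ = -⟪ψ, e i φ⟫)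
    (hη_adj : ∀ α (ψ φ : W), ⟪η α ψ, φ⟫ = ⟪ψ, η α φ⟫)
    (J : Matrix (Fin m) (Fin n) ℝ) (μ : ℝ) (hμ : μ ≥ traceNorm J) (ψ : W) :
    μ * ‖ψ‖ ^ 2 + ∑ α : Fin m, ∑ i : Fin n, J α i * (⟪e i (η α ψ), ψ⟫).re ≥ 0 := by
  obtain ⟨u, v, hu, hv, hJ⟩ := exists_rankOne_decomposition J
  let E : Fin m → W → W := fun s φ => ∑ i, (v s i : ℂ) • e i φ
  let H : Fin m → W := fun s => ∑ α, (u s α : ℂ) • η α ψ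
  have hH : ∀ s, ‖H s‖ = ‖ψ‖ := fun s => by
    have h := norm_sq_sum_smul_clifford_apply η 1 (by simp) (by simpa using hη)
      (by simpa using hη_adj) ψ (u s)
    rw [hu, one_mul] at h
    exact (sq_eq_sq₀ (norm_nonneg _) (norm_nonneg _)).mp h
  have hE : ∀ s φ, ‖E s φ‖ =
      √((Matrix.isHermitian_mul_conjTranspose_self J).eigenvalues s) * ‖φ‖ := fun s φ => by
    have h := norm_sq_sum_smul_clifford_apply e (-1) (by simp) (by simpa using he)
      (by simpa using he_adj) φ (v s)
    rw [← Real.sqrt_sq (norm_nonneg (E s φ)), h, hv, Real.sqrt_mul' _ (sq_nonneg _),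
      Real.sqrt_sq (norm_nonneg _)]
  have hsum : ∑ α, ∑ i, J α i * (⟪e i (η α ψ), ψ⟫).re = ∑ s, (⟪E s (H s), ψ⟫).re := by
    simp only [E, H, hJ, map_sum, map_smul, Finset.smul_sum, sum_inner, inner_smul_left,
      Complex.conj_ofReal, Complex.re_sum, Complex.re_ofReal_mul, Finset.sum_mul]
    rw [Finset.sum_congr rfl fun α _ => Finset.sum_comm, Finset.sum_comm]
    refine Finset.sum_congr rfl fun s _ => ?_
    rw [Finset.sum_comm]
    refine Finset.sum_congr rfl fun i _ => Finset.sum_congr rfl fun α _ => ?_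
    ring
  have hbound : -(traceNorm J * ‖ψ‖ ^ 2) ≤ ∑ s, (⟪E s (H s), ψ⟫).re := by
    rw [traceNorm, Finset.sum_mul, ← Finset.sum_neg_distrib]
    refine Finset.sum_le_sum fun s _ => neg_le_of_abs_le ?_
    calc |(⟪E s (H s), ψ⟫).re| ≤ ‖E s (H s)‖ * ‖ψ‖ :=
          (Complex.abs_re_le_norm _).trans (norm_inner_le_norm _ _)
      _ = _ := by rw [hE, hH]; ring
  rw [hsum]
  linarith [mul_le_mul_of_nonneg_right hμ (sq_nonneg ‖ψ‖)]
end

section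
/- A family ψ = (ψ_b)_{b∈{0,1}^m} ∈ 𝑆̄ satisfies E_α H_α ψ = ψ for every 1 ≤ α ≤ m if and only if for every b ∈ {0,1}^m, writing {β_1 < β_2 < ⋯ < β_j} = {α : b_α = 1} for the set of positions of the 1-bits of b, one has ψ_b = (−1)^{j(j+1)/2} · e_{β_j} ∘ ⋯ ∘ e_{β_1} (ψ_{(0,…,0)}). -/
/-- The product of the values of `f` over `s`, in decreasing order of the index. -/
def descProd {ι R : Type*} [LinearOrder ι] [Monoid R] (f : ι → R) (s : Finset ι) : R :=
  ((s.sort (· ≤ ·)).reverse.map f).prod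

lemma Finset.sort_insert_of_forall_lt {ι : Type*} [LinearOrder ι] {a : ι} {s : Finset ι}
    (h : ∀ x ∈ s, x < a) : (insert a s).sort (· ≤ ·) = s.sort (· ≤ ·) ++ [a] := by
  have ha : a ∉ s := fun h' => lt_irrefl a (h a h')
  refine List.Perm.eq_of_pairwise' (r := (· ≤ ·)) (Finset.pairwise_sort _ _) ?_ ?_
  · rw [List.pairwise_append]
    refine ⟨Finset.pairwise_sort _ _, List.pairwise_singleton _ _, ?_⟩
    intro x hx y hy
    rw [List.mem_singleton] at hy
    exact hy ▸ (h x ((Finset.mem_sort _).1 hx)).le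
  · rw [List.perm_ext_iff_of_nodup (Finset.sort_nodup _ _)]
    · simp [or_comm]
    · simpa [List.nodup_append] using fun x hx => (h x hx).ne

lemma descProd_empty {ι R : Type*} [LinearOrder ι] [Monoid R] (f : ι → R) :
    descProd f ∅ = 1 := by
  simp [descProd]

lemma descProd_insert_of_forall_lt {ι R : Type*} [LinearOrder ι] [Monoid R] (f : ι → R)
    {a : ι} {s : Finset ι} (h : ∀ x ∈ s, x < a) :
    descProd f (insert a s) = f a * descProd f s := by
  simp [descProd, Finset.sort_insert_of_forall_lt h]

/-- Inserting a factor into a decreasing product of anticommuting elements. -/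
lemma mul_descProd {ι R : Type*} [LinearOrder ι] [Ring R] {f : ι → R}
    (hf : ∀ i j, i ≠ j → f i * f j = -(f j * f i)) {a : ι} {s : Finset ι} (ha : a ∉ s) :
    f a * descProd f s = (-1) ^ (s.filter (a < ·)).card * descProd f (insert a s) := by
  induction s using Finset.induction_on_max with
  | empty => simp [descProd]
  | insert c t hc ih =>
    rw [Finset.mem_insert, not_or] at ha
    have hct : c ∉ t := fun h => lt_irrefl c (hc c h)
    rcases lt_or_gt_of_ne ha.1 with hac | hca
    · have hc' : ∀ x ∈ insert a t, x < c := by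
        simpa using ⟨hac, hc⟩
      rw [descProd_insert_of_forall_lt f hc, ← mul_assoc, hf a c ha.1, Finset.insert_comm,
        descProd_insert_of_forall_lt f hc', Finset.filter_insert, if_pos hac,
        Finset.card_insert_of_notMem (by simp [hct]), neg_mul, mul_assoc, ih ha.2, pow_succ,
        ← mul_assoc, ← mul_assoc, ← ((Commute.neg_one_left (f c)).pow_left _).eq]
      simp
    · have h : ∀ x ∈ insert c t, x < a := by
        simpa using ⟨hca, fun x hx => (hc x hx).trans hca⟩
      rw [descProd_insert_of_forall_lt f h,
        Finset.filter_false_of_mem fun x hx => (h x hx).not_gt]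
      simp

lemma neg_one_pow_triangle_succ {R : Type*} [Monoid R] [HasDistribNeg R] (j : ℕ) :
    (-1 : R) ^ ((j + 1) * (j + 1 + 1) / 2) = (-1) ^ (j + 1) * (-1) ^ (j * (j + 1) / 2) := by
  rw [← pow_add]
  congr 1
  rw [show (j + 1) * (j + 1 + 1) = j * (j + 1) + (j + 1) * 2 by ring,
    Nat.add_mul_div_right _ _ two_pos, add_comm]

lemma filter_update_true {ι : Type*} [Fintype ι] [DecidableEq ι] (b : ι → Bool) (a : ι) :
    (Finset.univ.filter fun i => Function.update b a true i = true)
      = insert a (Finset.univ.filter fun i => b i = true) := by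
  ext i
  by_cases h : i = a <;> simp [Function.update_apply, h]

lemma filter_update_false {ι : Type*} [Fintype ι] [DecidableEq ι] (b : ι → Bool) (a : ι) :
    (Finset.univ.filter fun i => Function.update b a false i = true)
      = (Finset.univ.filter fun i => b i = true).erase a := by
  ext i
  by_cases h : i = a <;> simp [Function.update_apply, h]

/-- characterization of the families `ψ = (ψ_b)_{b ∈ {0,1}^m}` in the doubled
spinor bundle `S^{2^m}` satisfying `E_α H_α ψ = ψ` for all `1 ≤ α ≤ m`, where
`(E_i ψ)_b = (−1)^{b_1+⋯+b_m} e_i(ψ_b)` and `(H_α ψ)_b = (−1)^{b_{α+1}+⋯+b_m} ψ_{σ_α(b)}`. -/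
theorem doubling_eigenspinor_characterization {n m : ℕ} (hm : 1 ≤ m) (hmn : m ≤ n)
    {S : Type*} [AddCommGroup S] [Module ℂ S]
    (e : Fin n → Module.End ℂ S)
    (he : ∀ i j, e i * e j + e j * e i = (if i = j then (-2 : ℂ) else 0) • 1)
    (ψ : (Fin m → Bool) → S) :
    (∀ α : Fin m, ∀ b : Fin m → Bool,
        ((-1 : ℂ) ^ ((Finset.univ.filter fun γ : Fin m => b γ = true).card
            + (Finset.univ.filter fun γ : Fin m => α < γ ∧ b γ = true).card))
          • e (Fin.castLE hmn α) (ψ (Function.update b α (!b α))) = ψ b)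
    ↔ (∀ b : Fin m → Bool,
        ψ b = ((-1 : ℂ) ^ (((Finset.univ.filter fun γ : Fin m => b γ = true).card
                * ((Finset.univ.filter fun γ : Fin m => b γ = true).card + 1)) / 2))
          • (List.prod
              ((((Finset.univ.filter fun γ : Fin m => b γ = true).sort (· ≤ ·)).reverse.map
                  fun β => e (Fin.castLE hmn β)))
              (ψ fun _ => false))) := by
  set f : Fin m → Module.End ℂ S := fun β => e (Fin.castLE hmn β)
  have anti : ∀ i j, i ≠ j → f i * f j = -(f j * f i) := fun i j hij => by
    have h := he (Fin.castLE hmn i) (Fin.castLE hmn j)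
    rw [if_neg (by simpa using hij), zero_smul] at h
    exact eq_neg_of_add_eq_zero_left h
  have sq : ∀ i, f i * f i = -1 := fun i => by
    have h := he (Fin.castLE hmn i) (Fin.castLE hmn i)
    rw [if_pos rfl, ← two_smul ℂ (_ * _), neg_smul, ← smul_neg] at h
    exact smul_right_injective _ (two_ne_zero (α := ℂ)) h
  have apply_descProd : ∀ {a : Fin m} {s : Finset (Fin m)}, a ∉ s → ∀ x : S,
      f a (descProd f s x) = (-1 : ℂ) ^ (s.filter (a < ·)).card • descProd f (insert a s) x := by
    intro a s ha x
    have h := congrArg (fun g : Module.End ℂ S => g x) (mul_descProd anti ha)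
    have hs : ((-1 : Module.End ℂ S) ^ (s.filter (a < ·)).card)
        = (-1 : ℂ) ^ (s.filter (a < ·)).card • 1 := by
      rcases Nat.even_or_odd (s.filter (a < ·)).card with h' | h' <;>
      simp [h'.neg_one_pow]
    rw [hs] at h
    simpa using h
  have neg_one_pow_mul_self : ∀ k : ℕ, (-1 : ℂ) ^ k * (-1) ^ k = 1 := fun k => by
    rw [← mul_pow]; simp
  have filter_lt : ∀ (α : Fin m) (b : Fin m → Bool),
      (Finset.univ.filter fun γ : Fin m => α < γ ∧ b γ = true)
        = (Finset.univ.filter fun γ : Fin m => b γ = true).filter (α < ·) := fun α b => by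
    ext; simp [and_comm]
  simp only [filter_lt]
  change (∀ (α : Fin m) (b : Fin m → Bool), _ • f α (ψ (Function.update b α (!b α))) = ψ b) ↔
    ∀ b, ψ b = _ • descProd f (Finset.univ.filter fun γ : Fin m => b γ = true) (ψ fun _ => false)
  constructor
  · intro H b
    generalize hs : (Finset.univ.filter fun γ : Fin m => b γ = true) = s
    induction s using Finset.induction_on_max generalizing b with
    | empty =>
      have hb : b = fun _ => false := by
        funext i
        simpa using (Finset.filter_eq_empty_iff.1 hs) (Finset.mem_univ i)
      simp [hb, descProd_empty]
    | insert a t ht ih =>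
      have hat : a ∉ t := fun h => lt_irrefl a (ht a h)
      have hba : b a = true := by
        have : a ∈ Finset.univ.filter fun γ : Fin m => b γ = true := by simp [hs]
        simpa using this
      have hlt : (insert a t).filter (a < ·) = ∅ :=
        Finset.filter_false_of_mem (by simpa using fun x hx => (ht x hx).le)
      have ht' := ih (Function.update b a false) (by
        rw [filter_update_false, hs, Finset.erase_insert hat])
      rw [← H a b, hba, Bool.not_true, ht', hs, hlt, descProd_insert_of_forall_lt f ht,
        Finset.card_insert_of_notMem hat, neg_one_pow_triangle_succ]
      simp [mul_smul]
  · intro H α b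
    rw [H b, H (Function.update b α _)]
    generalize ψ (fun _ => false) = x
    cases hb : b α with
    | true =>
      rw [Bool.not_true, filter_update_false]
      obtain ⟨t, hαt, ht⟩ : ∃ t, α ∉ t ∧
          (Finset.univ.filter fun γ : Fin m => b γ = true) = insert α t :=
        ⟨_, Finset.notMem_erase α _, (Finset.insert_erase (by simpa using hb)).symm⟩
      rw [ht, Finset.erase_insert hαt, Finset.filter_insert, if_neg (lt_irrefl α),
        Finset.card_insert_of_notMem hαt, map_smul, apply_descProd hαt, smul_smul, smul_smul,
        neg_one_pow_triangle_succ]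
      congr 1
      rw [pow_add]
      linear_combination (-1 : ℂ) ^ (t.card + 1) * (-1) ^ (t.card * (t.card + 1) / 2) *
        neg_one_pow_mul_self (t.filter (α < ·)).card
    | false =>
      rw [Bool.not_false, filter_update_true]
      have hα : α ∉ Finset.univ.filter fun γ : Fin m => b γ = true := by simpa using hb
      generalize (Finset.univ.filter fun γ : Fin m => b γ = true) = s at hα
      have hins : descProd f (insert α s) x
          = (-1 : ℂ) ^ (s.filter (α < ·)).card • f α (descProd f s x) := by
        rw [apply_descProd hα, smul_smul, neg_one_pow_mul_self, one_smul]
      have hsq : f α (f α (descProd f s x)) = (-1 : ℂ) • descProd f s x := by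
        rw [← Module.End.mul_apply, sq]; simp
      rw [Finset.card_insert_of_notMem hα, hins, map_smul, map_smul, hsq, smul_smul, smul_smul,
        smul_smul, neg_one_pow_triangle_succ]
      congr 1
      rw [pow_add, pow_succ]
      linear_combination ((-1 : ℂ) ^ s.card * (-1) ^ s.card * (-1) ^ (s.card * (s.card + 1) / 2)) *
        neg_one_pow_mul_self (s.filter (α < ·)).card +
        (-1 : ℂ) ^ (s.card * (s.card + 1) / 2) * neg_one_pow_mul_self s.card
end

section
/- Assume m ≤ n, and suppose ψ ∈ W satisfies e_α η_α ψ = ψ for every 1 ≤ α ≤ m. Then for every c = (c_1,…,c_m) ∈ ℝ^m with Σ_α c_α² = 1: Σ_{i=1}^{n} ( Re⟨ e_i (Σ_{α=1}^{m} c_α η_α) ψ, ψ⟩ )² = ‖ψ‖⁴. In particular, taking c the α-th standard basis vector, the vector X^α(ψ) ∈ ℝⁿ with components X^α_i(ψ) = Re⟨e_i η_α ψ, ψ⟩ satisfies |X^α(ψ)| = ‖ψ‖² for each α, i.e. ψ is a null spinor. -/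
open scoped ComplexInnerProductSpace

/-- For skew-adjoint operators `e i` satisfying the Clifford relations, the real part of
`⟪e i (e j ψ), ψ⟫` is `-‖ψ‖ ^ 2` on the diagonal and vanishes off it. -/
theorem re_inner_clifford_clifford {ι W : Type*} [DecidableEq ι]
    [NormedAddCommGroup W] [InnerProductSpace ℂ W] (e : ι → Module.End ℂ W)
    (he : ∀ i j, e i * e j + e j * e i = (if i = j then (-2 : ℂ) else 0) • 1)
    (he_adj : ∀ i (ψ φ : W), ⟪e i ψ, φ⟫ = -⟪ψ, e i φ⟫) (i j : ι) (ψ : W) :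
    (⟪e i (e j ψ), ψ⟫).re = if i = j then -‖ψ‖ ^ 2 else 0 := by
  have hsymm : (⟪e i (e j ψ), ψ⟫).re = (⟪e j (e i ψ), ψ⟫).re := by
    rw [he_adj, he_adj, neg_neg]
    exact inner_re_symm (𝕜 := ℂ) ψ (e j (e i ψ))
  have hsum : e i (e j ψ) + e j (e i ψ) = (if i = j then (-2 : ℂ) else 0) • ψ := by
    exact LinearMap.congr_fun (he i j) ψ
  have hre : (⟪e i (e j ψ), ψ⟫).re + (⟪e j (e i ψ), ψ⟫).re =
      if i = j then -2 * ‖ψ‖ ^ 2 else 0 := by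
    rw [← Complex.add_re, ← inner_add_left, hsum]
    split_ifs
    · rw [inner_smul_left, inner_self_eq_norm_sq_to_K]
      simp [← Complex.ofReal_pow]
    · simp
  split_ifs at hre ⊢ <;> linarith

/-- if `e_α η_α ψ = ψ` for all `α`, then for every unit vector
`c ∈ ℝ^m`, `Σ_i (Re⟨e_i (Σ_α c_α η_α) ψ, ψ⟩)² = ‖ψ‖⁴`; in particular
`|X^α(ψ)| = ‖ψ‖²` for each `α`, i.e. `ψ` is a null spinor. -/
theorem eigenspinor_is_null {n m : ℕ} (hn : 0 < n) (hm : 0 < m) (hmn : m ≤ n)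
    {W : Type*} [NormedAddCommGroup W] [InnerProductSpace ℂ W]
    (e : Fin n → Module.End ℂ W) (η : Fin m → Module.End ℂ W)
    (he : ∀ i j, e i * e j + e j * e i = (if i = j then (-2 : ℂ) else 0) • 1)
    (hη : ∀ α β, η α * η β + η β * η α = (if α = β then (2 : ℂ) else 0) • 1)
    (heη : ∀ i α, e i * η α + η α * e i = 0)
    (he_adj : ∀ i (ψ φ : W), ⟪e i ψ, φ⟫ = -⟪ψ, e i φ⟫)
    (hη_adj : ∀ α (ψ φ : W), ⟪η α ψ, φ⟫ = ⟪ψ, η α φ⟫)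
    (ψ : W) (hψ : ∀ α : Fin m, e (Fin.castLE hmn α) (η α ψ) = ψ) :
    (∀ c : Fin m → ℝ, (∑ α : Fin m, c α ^ 2) = 1 →
        ∑ i : Fin n, ((⟪e i (∑ α : Fin m, (c α : ℂ) • η α ψ), ψ⟫).re) ^ 2 = ‖ψ‖ ^ 4) ∧
    (∀ α : Fin m,
        Real.sqrt (∑ i : Fin n, ((⟪e i (η α ψ), ψ⟫).re) ^ 2) = ‖ψ‖ ^ 2) := by
  have hηψ (α : Fin m) : η α ψ = -e (Fin.castLE hmn α) ψ := by
    have hsq : e (Fin.castLE hmn α) (e (Fin.castLE hmn α) (η α ψ)) +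
        e (Fin.castLE hmn α) (e (Fin.castLE hmn α) (η α ψ)) = (-2 : ℂ) • η α ψ := by
      have h := LinearMap.congr_fun (he (Fin.castLE hmn α) (Fin.castLE hmn α)) (η α ψ)
      rw [if_pos rfl] at h
      exact h
    rw [hψ, ← two_smul ℂ, neg_smul, ← smul_neg] at hsq
    rw [smul_right_injective W (two_ne_zero (α := ℂ)) hsq, neg_neg]
  have hre (i : Fin n) (α : Fin m) :
      (⟪e i (η α ψ), ψ⟫).re = if i = Fin.castLE hmn α then ‖ψ‖ ^ 2 else 0 := by
    rw [hηψ, map_neg, inner_neg_left, Complex.neg_re, re_inner_clifford_clifford e he he_adj]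
    split_ifs <;> simp
  have hcomp (c : Fin m → ℝ) (i : Fin n) :
      (⟪e i (∑ α : Fin m, (c α : ℂ) • η α ψ), ψ⟫).re =
        ∑ α, c α * if i = Fin.castLE hmn α then ‖ψ‖ ^ 2 else 0 := by
    simp only [map_sum, map_smul, sum_inner, Complex.re_sum, inner_smul_left, Complex.conj_ofReal,
      Complex.re_ofReal_mul, hre]
  have hunit (c : Fin m → ℝ) (hc : (∑ α : Fin m, c α ^ 2) = 1) :
      ∑ i : Fin n, ((⟪e i (∑ α : Fin m, (c α : ℂ) • η α ψ), ψ⟫).re) ^ 2 = ‖ψ‖ ^ 4 := by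
    simp only [hcomp]
    rw [← Fintype.sum_of_injective (Fin.castLE hmn) (Fin.castLE_injective hmn)
      (fun α ↦ c α ^ 2 * ‖ψ‖ ^ 4), ← Finset.sum_mul, hc, one_mul]
    · intro i hi
      have hne (α : Fin m) : i ≠ Fin.castLE hmn α := fun h ↦ hi ⟨α, h.symm⟩
      simp [hne]
    · intro α
      simp only [(Fin.castLE_injective hmn).eq_iff, mul_ite, mul_zero, Finset.sum_ite_eq,
        Finset.mem_univ, if_true]
      ring
  refine ⟨hunit, fun α ↦ ?_⟩
  have hα := hunit (Pi.single α 1) (by simp [Pi.single_apply])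
  simp only [Pi.single_apply, Complex.ofReal_one, Complex.ofReal_zero, apply_ite Complex.ofReal,
    ite_smul, one_smul, zero_smul, Finset.sum_ite_eq', Finset.mem_univ, if_true] at hα
  rw [hα, show ‖ψ‖ ^ 4 = (‖ψ‖ ^ 2) ^ 2 by ring, Real.sqrt_sq (by positivity)]
end

section
/- Let W be a nonzero complex vector space equipped with ℂ-linear endomorphisms e_1,…,e_m and η_1,…,η_m satisfying e_a e_b + e_b e_a = −2δ_{ab}·id_W, η_a η_b + η_b η_a = 2δ_{ab}·id_W, and e_a η_b + η_b e_a = 0 for all 1 ≤ a,b ≤ m. Then for every choice of signs ε = (ε_1,…,ε_m) ∈ {−1,+1}^m there exists a nonzero ψ ∈ W such that e_a η_a ψ = ε_a · ψ for every 1 ≤ a ≤ m. -/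
/-- Commuting involutions `T a`, each of which anticommutes with an invertible operator `η a` that
commutes with the other `T b`, have joint eigenvectors for every pattern of signs. -/
theorem exists_joint_eigenvector_of_anticommute {R W ι : Type*} [CommRing R] [AddCommGroup W]
    [Module R W] [Nontrivial W] [Fintype ι] (T η : ι → Module.End R W)
    (hTT : ∀ a x, T a (T a x) = x) (hcomm : ∀ a b, a ≠ b → ∀ x, T a (T b x) = T b (T a x))
    (hηη : ∀ a x, η a (η a x) = x) (hanti : ∀ a x, T a (η a x) = -η a (T a x))
    (hcross : ∀ a b, a ≠ b → ∀ x, T a (η b x) = η b (T a x))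
    (ε : ι → R) (hε : ∀ a, ε a * ε a = 1) :
    ∃ ψ : W, ψ ≠ 0 ∧ ∀ a, T a ψ = ε a • ψ := by
  classical
  suffices h : ∀ s : Finset ι, ∃ ψ : W, ψ ≠ 0 ∧ ∀ a ∈ s, T a ψ = ε a • ψ by
    simpa using h Finset.univ
  intro s
  induction s using Finset.induction_on with
  | empty => simpa using exists_ne (0 : W)
  | insert a s ha ih =>
    obtain ⟨ψ, hψ, hs⟩ := ih
    have hne : ∀ b ∈ s, b ≠ a := fun b hb hba => ha (hba ▸ hb)
    by_cases h0 : ψ + ε a • T a ψ = 0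
    · refine ⟨η a ψ, fun h => hψ (by rw [← hηη a ψ, h, map_zero]), fun b hb => ?_⟩
      rcases Finset.mem_insert.mp hb with rfl | hb
      · have hT : T b ψ = -(ε b • ψ) := by
          apply eq_neg_of_add_eq_zero_right
          rw [← one_smul R (T b ψ), ← hε b, mul_smul, ← smul_add, h0, smul_zero]
        rw [hanti, hT, map_neg, neg_neg, map_smul]
      · rw [hcross b a (hne b hb), hs b hb, map_smul]
    · refine ⟨ψ + ε a • T a ψ, h0, fun b hb => ?_⟩
      rcases Finset.mem_insert.mp hb with rfl | hb
      · rw [map_add, map_smul, hTT, smul_add, smul_smul, hε, one_smul, add_comm]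
      · rw [map_add, map_smul, hcomm b a (hne b hb), hs b hb, map_smul, smul_add,
          smul_comm (ε b)]

/-- in a nonzero complex representation of the Clifford relations of
signature `(m, m)`, the pairwise commuting involutions `−e_a η_a` admit a simultaneous
eigenvector with any prescribed pattern of eigenvalues `±1`: for every choice of signs
`ε ∈ {−1,+1}^m` there is a nonzero `ψ` with `e_a η_a ψ = ε_a ψ` for all `a`. -/
theorem exists_simultaneous_sign_eigenspinor {m : ℕ} (hm : 0 < m)
    {W : Type*} [AddCommGroup W] [Module ℂ W] [Nontrivial W]
    (e : Fin m → Module.End ℂ W) (η : Fin m → Module.End ℂ W)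
    (he : ∀ a b, e a * e b + e b * e a = (if a = b then (-2 : ℂ) else 0) • 1)
    (hη : ∀ a b, η a * η b + η b * η a = (if a = b then (2 : ℂ) else 0) • 1)
    (heη : ∀ a b, e a * η b + η b * e a = 0)
    (ε : Fin m → ℝ) (hε : ∀ a, ε a = 1 ∨ ε a = -1) :
    ∃ ψ : W, ψ ≠ 0 ∧ ∀ a : Fin m, e a (η a ψ) = (ε a : ℂ) • ψ := by
  have hee : ∀ a x, e a (e a x) = -x := fun a x => by
    have h := LinearMap.congr_fun (he a a) x
    simp only [if_true, LinearMap.add_apply, Module.End.mul_apply, LinearMap.smul_apply,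
      ← two_smul ℂ (e a (e a x)), neg_smul, ← smul_neg] at h
    exact smul_right_injective W (two_ne_zero' ℂ) h
  have hηη : ∀ a x, η a (η a x) = x := fun a x => by
    have h := LinearMap.congr_fun (hη a a) x
    simp only [if_true, LinearMap.add_apply, Module.End.mul_apply, LinearMap.smul_apply,
      Module.End.one_apply, ← two_smul ℂ (η a (η a x))] at h
    exact smul_right_injective W (two_ne_zero' ℂ) h
  have he_anti : ∀ a b, a ≠ b → ∀ x, e a (e b x) = -e b (e a x) := fun a b hab x =>
    eq_neg_of_add_eq_zero_left (by simpa [hab] using LinearMap.congr_fun (he a b) x)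
  have hη_anti : ∀ a b, a ≠ b → ∀ x, η a (η b x) = -η b (η a x) := fun a b hab x =>
    eq_neg_of_add_eq_zero_left (by simpa [hab] using LinearMap.congr_fun (hη a b) x)
  have hηe : ∀ a b x, η b (e a x) = -e a (η b x) := fun a b x =>
    eq_neg_of_add_eq_zero_right (by simpa using LinearMap.congr_fun (heη a b) x)
  refine exists_joint_eigenvector_of_anticommute (fun a => e a * η a) η ?_ ?_ hηη ?_ ?_
    (fun a => (ε a : ℂ)) fun a => by rcases hε a with h | h <;> simp [h]
  · intro a x
    simp [hηe, hee, hηη]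
  · intro a b hab x
    simp [hηe, he_anti a b hab, hη_anti a b hab]
  · intro a x
    simp [hηe]
  · intro a b hab x
    simp [hηe, hη_anti a b hab]
end

section
/- Assume m ≤ n and W ≠ {0}. Let P be a real m×n matrix and let E ∈ ℝ. If E·‖ψ‖² + Σ_{α=1}^{m} Σ_{i=1}^{n} P_{αi} · Re⟨e_i η_α ψ, ψ⟩ ≥ 0 holds for every ψ ∈ W, then E ≥ ‖P‖_tr. -/
open scoped ComplexInnerProductSpace

open Matrix in
/-- Anticommutators are bilinear: if `e i * f j + f j * e i = C i j • 1`, then the linear combinations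
of the `e i` and `f j` with coefficient matrices `Q` and `U` have anticommutator matrix `Qᵀ * C * U`. -/
theorem sum_smul_anticommutator {R A ι κ σ τ : Type*} [CommRing R] [Ring A] [Algebra R A]
    [Fintype ι] [Fintype κ] (e : ι → A) (f : κ → A) (C : Matrix ι κ R)
    (h : ∀ i j, e i * f j + f j * e i = C i j • (1 : A))
    (Q : Matrix ι σ R) (U : Matrix κ τ R) (s : σ) (t : τ) :
    (∑ i, Q i s • e i) * (∑ j, U j t • f j) + (∑ j, U j t • f j) * (∑ i, Q i s • e i)
      = (Qᵀ * C * U) s t • (1 : A) := by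
  have h1 : (∑ j, U j t • f j) * (∑ i, Q i s • e i)
      = ∑ i, ∑ j, (Q i s * U j t) • (f j * e i) := by
    rw [Finset.sum_mul_sum, Finset.sum_comm]
    simp only [smul_mul_smul_comm, mul_comm]
  have h2 : (Qᵀ * C * U) s t = ∑ i, ∑ j, (Q i s * U j t) * C i j := by
    simp only [Matrix.mul_apply, Matrix.transpose_apply, Finset.sum_mul]
    rw [Finset.sum_comm]
    simp only [mul_right_comm]
  rw [h1, h2, Finset.sum_mul_sum, ← Finset.sum_add_distrib]
  simp only [smul_mul_smul_comm, ← Finset.sum_add_distrib, ← smul_add, h, Finset.sum_smul, smul_smul]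

/-- Clifford generators `a s` with squares `-(c s)²` and `b s` with squares `1`, all
anticommuting, admit a common eigenvector of the products `a s * b s` for the eigenvalues `-c s`. -/
theorem exists_common_eigenvector {K W σ : Type*} [Field K] [CharZero K] [AddCommGroup W] [Module K W]
    [Nontrivial W] [DecidableEq σ] (a b : σ → Module.End K W) (c : σ → K)
    (ha : ∀ s t, a s * a t + a t * a s = (if s = t then -2 * c s ^ 2 else 0) • 1)
    (hb : ∀ s t, b s * b t + b t * b s = (if s = t then (2 : K) else 0) • 1)
    (hab : ∀ s t, a s * b t + b t * a s = 0) (S : Finset σ) :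
    ∃ ψ : W, ψ ≠ 0 ∧ ∀ s ∈ S, a s (b s ψ) = -(c s • ψ) := by
  have aa : ∀ s ψ, a s (a s ψ) = -(c s ^ 2 • ψ) := by
    intro s ψ
    have := congrArg (fun F => F ψ) (ha s s)
    simp only [if_true, Module.End.mul_apply, LinearMap.smul_apply,
      ← two_smul K, mul_smul, neg_smul] at this
    rw [← smul_neg] at this
    exact smul_right_injective W (two_ne_zero (α := K)) this
  have bb : ∀ s ψ, b s (b s ψ) = ψ := by
    intro s ψ
    have := congrArg (fun F => F ψ) (hb s s)
    simp only [if_true, Module.End.mul_apply, LinearMap.smul_apply,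
      Module.End.one_apply, ← two_smul K] at this
    exact smul_right_injective W (two_ne_zero (α := K)) this
  have aa' : ∀ s t, s ≠ t → ∀ ψ, a s (a t ψ) = -a t (a s ψ) := fun s t hst ψ =>
    eq_neg_of_add_eq_zero_left (by simpa [hst] using congrArg (fun F => F ψ) (ha s t))
  have bb' : ∀ s t, s ≠ t → ∀ ψ, b s (b t ψ) = -b t (b s ψ) := fun s t hst ψ =>
    eq_neg_of_add_eq_zero_left (by simpa [hst] using congrArg (fun F => F ψ) (hb s t))
  have ba : ∀ s t ψ, b t (a s ψ) = -a s (b t ψ) := fun s t ψ =>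
    eq_neg_of_add_eq_zero_right (by simpa using congrArg (fun F => F ψ) (hab s t))
  induction S using Finset.induction_on with
  | empty => simpa using exists_ne (0 : W)
  | insert t S ht ih =>
    obtain ⟨ψ, hψ, hS⟩ := ih
    have hne : ∀ s ∈ S, s ≠ t := fun s hs h => ht (h ▸ hs)
    by_cases hφ : c t • ψ - a t (b t ψ) = 0
    · by_cases hc : c t = 0
      · refine ⟨ψ, hψ, fun s hs => ?_⟩
        obtain rfl | hs := Finset.mem_insert.1 hs
        · simpa [hc] using hφ
        · exact hS s hs
      · refine ⟨a t ψ, fun h0 => ?_, fun s hs => ?_⟩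
        · have := aa t ψ
          rw [h0] at this
          simp [hc, hψ] at this
        · obtain rfl | hs := Finset.mem_insert.1 hs
          · rw [ba, ← sub_eq_zero.1 hφ]
            simp
          · rw [ba, map_neg, aa' s t (hne s hs), neg_neg, hS s hs]
            simp
    · refine ⟨_, hφ, fun s hs => ?_⟩
      obtain rfl | hs := Finset.mem_insert.1 hs
      · simp only [map_sub, map_smul, ba, bb, map_neg, aa, smul_sub, smul_smul, pow_two]
        abel
      · have : a s (b s (a t (b t ψ))) = a t (b t (a s (b s ψ))) := by
          simp only [ba, map_neg, aa' s t (hne s hs), bb' s t (hne s hs), neg_neg]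
        rw [map_sub, map_sub, this, map_smul, map_smul, hS s hs]
        simp only [map_neg, map_smul, smul_sub, smul_neg, smul_comm (c t) (c s)]
        abel

open Matrix in
/-- For a real matrix `P` there is an orthogonal matrix `U` such that the columns of `Pᵀ * U` are
orthogonal, with lengths summing to the trace norm of `P`. -/
theorem exists_orthogonal_transpose_mul {m n : ℕ} (P : Matrix (Fin m) (Fin n) ℝ) :
    ∃ (U : Matrix (Fin m) (Fin m) ℝ) (c : Fin m → ℝ), Uᵀ * U = 1 ∧ U * Uᵀ = 1 ∧
      (Pᵀ * U)ᵀ * (Pᵀ * U) = diagonal (fun s => c s ^ 2) ∧ ∑ s, c s = traceNorm P := by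
  let hP := Matrix.isHermitian_mul_conjTranspose_self P
  have hU : star (hP.eigenvectorUnitary : Matrix (Fin m) (Fin m) ℝ)
      = (hP.eigenvectorUnitary : Matrix (Fin m) (Fin m) ℝ)ᵀ := by
    rw [star_eq_conjTranspose, conjTranspose_eq_transpose_of_trivial]
  refine ⟨hP.eigenvectorUnitary, fun s => √(hP.eigenvalues s), ?_, ?_, ?_, rfl⟩
  · rw [← hU]; exact Unitary.coe_star_mul_self _
  · rw [← hU]; exact Unitary.coe_mul_star_self _
  · have := hP.conjStarAlgAut_star_eigenvectorUnitary
    rw [Unitary.conjStarAlgAut_star_apply, hU] at this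
    rw [transpose_mul, transpose_transpose, Matrix.mul_assoc, ← Matrix.mul_assoc P,
      ← Matrix.mul_assoc, ← conjTranspose_eq_transpose_of_trivial P, this]
    congr 1
    funext s
    exact (Real.sq_sqrt ((Matrix.posSemidef_self_mul_conjTranspose P).eigenvalues_nonneg s)).symm

/-- if `E‖ψ‖² + Σ_{α,i} P_{αi} Re⟨e_i η_α ψ, ψ⟩ ≥ 0` for every spinor `ψ`
in a nonzero Clifford module of signature `(n, m)` with `m ≤ n`, then `E ≥ ‖P‖_tr`. -/
theorem energy_ge_traceNorm {n m : ℕ} (hn : 0 < n) (hm : 0 < m) (hmn : m ≤ n)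
    {W : Type*} [NormedAddCommGroup W] [InnerProductSpace ℂ W] [Nontrivial W]
    (e : Fin n → Module.End ℂ W) (η : Fin m → Module.End ℂ W)
    (he : ∀ i j, e i * e j + e j * e i = (if i = j then (-2 : ℂ) else 0) • 1)
    (hη : ∀ α β, η α * η β + η β * η α = (if α = β then (2 : ℂ) else 0) • 1)
    (heη : ∀ i α, e i * η α + η α * e i = 0)
    (he_adj : ∀ i (ψ φ : W), ⟪e i ψ, φ⟫ = -⟪ψ, e i φ⟫)
    (hη_adj : ∀ α (ψ φ : W), ⟪η α ψ, φ⟫ = ⟪ψ, η α φ⟫)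
    (P : Matrix (Fin m) (Fin n) ℝ) (E : ℝ)
    (h : ∀ ψ : W,
      E * ‖ψ‖ ^ 2 + ∑ α : Fin m, ∑ i : Fin n, P α i * (⟪e i (η α ψ), ψ⟫).re ≥ 0) :
    E ≥ traceNorm P := by
  obtain ⟨U, c, hUU, hUU', hQ, hc⟩ := exists_orthogonal_transpose_mul P
  set Q := P.transpose * U with hQdef
  let UC : Matrix (Fin m) (Fin m) ℂ := U.map Complex.ofRealHom
  let QC : Matrix (Fin n) (Fin m) ℂ := Q.map Complex.ofRealHom
  have hUC : UC.transpose * UC = 1 := by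
    simp only [UC, ← Matrix.transpose_map, ← Matrix.map_mul, hUU]
    simp
  have hQC : QC.transpose * QC = Matrix.diagonal (fun s => (c s : ℂ) ^ 2) := by
    simp only [QC, ← Matrix.transpose_map, ← Matrix.map_mul, hQ]
    simp [Matrix.diagonal_map]
  have hQU : QC * UC.transpose = P.transpose.map Complex.ofRealHom := by
    simp only [QC, UC, ← Matrix.transpose_map, ← Matrix.map_mul, hQdef, Matrix.mul_assoc, hUU',
      Matrix.mul_one]
  let a : Fin m → Module.End ℂ W := fun s => ∑ i, QC i s • e i
  let b : Fin m → Module.End ℂ W := fun s => ∑ α, UC α s • η α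
  obtain ⟨ψ, hψ, hab⟩ := exists_common_eigenvector a b (fun s => (c s : ℂ))
    (fun s t => by
      rw [sum_smul_anticommutator e e ((-2 : ℂ) • 1)
        (fun i j => by rw [he]; simp [Matrix.one_apply]) QC QC s t]
      split_ifs <;> simp_all)
    (fun s t => by
      rw [sum_smul_anticommutator η η ((2 : ℂ) • 1)
        (fun i j => by rw [hη]; simp [Matrix.one_apply]) UC UC s t]
      simp [hUC, Matrix.one_apply])
    (fun s t => by
      rw [sum_smul_anticommutator e η 0 (fun i j => by rw [heη]; simp) QC UC s t]
      simp)
    Finset.univ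
  have hsum : ∑ α, ∑ i, (P α i : ℂ) • e i (η α ψ) = ∑ s, a s (b s ψ) := by
    have hP (α : Fin m) (i : Fin n) : (P α i : ℂ) = ∑ s, QC i s * UC α s :=
      (congrFun (congrFun hQU i) α).symm
    simp only [hP, a, b, LinearMap.sum_apply, LinearMap.smul_apply, map_sum, map_smul,
      Finset.smul_sum, Finset.sum_smul, smul_smul]
    rw [Finset.sum_comm_cycle]
    simp only [mul_comm]
  have hinner : ∑ α, ∑ i, P α i * (⟪e i (η α ψ), ψ⟫).re = -(traceNorm P * ‖ψ‖ ^ 2) := by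
    have h1 := congrArg (fun x => (⟪x, ψ⟫).re) hsum
    simp only [fun s => hab s (Finset.mem_univ s), sum_inner, inner_neg_left, inner_smul_left,
      Complex.re_sum, Complex.conj_ofReal, Complex.re_ofReal_mul, Complex.neg_re] at h1
    rw [h1, ← hc, Finset.sum_mul, Finset.sum_neg_distrib]
    simp [inner_self_eq_norm_sq_to_K, ← Complex.ofReal_pow]
  have hE := h ψ
  rw [hinner] at hE
  have hpos : 0 < ‖ψ‖ ^ 2 := by positivity
  exact le_of_mul_le_mul_right (by linarith) hpos
end
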